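/- For any real constants c₁, c₂, the function f(x¹,x²,x³,x⁴) = ((a + b)/12)(x⁴)³ + ((p + s)/4)(x⁴)² + c₁x⁴ + c₂ satisfies the steady gradient Ricci soliton equation 2(Hess f)_{ij} + ρ_{ij} = 0 at every point of ℝ⁴. -/

import Mathlib

noncomputable section

open scoped BigOperators

/-- The metric of a four-dimensional two-symmetric Lorentzian manifold, in
coordinates `x 0 = x¹, x 1 = x², x 2 = x³, x 3 = x⁴`:
`g₁₄ = g₄₁ = g₂₂ = g₃₃ = 1`,
`g₄₄ = x⁴(a(x²)² + b(x³)²) + p(x²)² + 2q x²x³ + s(x³)²`, all others zero. -/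
def gmat (a b p q s : ℝ) (x : Fin 4 → ℝ) : Matrix (Fin 4) (Fin 4) ℝ :=
  Matrix.of fun i j =>
    if i = 0 ∧ j = 3 then 1
    else if i = 3 ∧ j = 0 then 1
    else if i = 1 ∧ j = 1 then 1
    else if i = 2 ∧ j = 2 then 1
    else if i = 3 ∧ j = 3 then
      x 3 * (a * (x 1) ^ 2 + b * (x 2) ^ 2) + p * (x 1) ^ 2
        + 2 * q * x 1 * x 2 + s * (x 2) ^ 2
    else 0

/-- The inverse matrix `g^{ij}`. -/
def ginv (a b p q s : ℝ) (x : Fin 4 → ℝ) : Matrix (Fin 4) (Fin 4) ℝ :=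
  (gmat a b p q s x)⁻¹

/-- Partial derivative `∂_i` of a function on ℝ⁴. -/
def pd (i : Fin 4) (f : (Fin 4 → ℝ) → ℝ) (x : Fin 4 → ℝ) : ℝ :=
  fderiv ℝ f x (Pi.single i 1)

/-- Christoffel symbols `Γ^k_{ij} = (1/2) Σ_l g^{kl}(∂_i g_{jl} + ∂_j g_{il} − ∂_l g_{ij})`. -/
def Gam (a b p q s : ℝ) (k i j : Fin 4) (x : Fin 4 → ℝ) : ℝ :=
  (1 / 2) * ∑ l, ginv a b p q s x k l *
    (pd i (fun y => gmat a b p q s y j l) x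
      + pd j (fun y => gmat a b p q s y i l) x
      - pd l (fun y => gmat a b p q s y i j) x)

/-- Curvature tensor
`R^i_{jkl} = ∂_k Γ^i_{lj} − ∂_l Γ^i_{kj} + Σ_m (Γ^i_{km} Γ^m_{lj} − Γ^i_{lm} Γ^m_{kj})`. -/
def Riem (a b p q s : ℝ) (i j k l : Fin 4) (x : Fin 4 → ℝ) : ℝ :=
  pd k (Gam a b p q s i l j) x - pd l (Gam a b p q s i k j) x
    + ∑ m, (Gam a b p q s i k m x * Gam a b p q s m l j x
      - Gam a b p q s i l m x * Gam a b p q s m k j x)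

/-- Ricci tensor `ρ_{jl} = Σ_i R^i_{jil}`. -/
def Ric (a b p q s : ℝ) (j l : Fin 4) (x : Fin 4 → ℝ) : ℝ :=
  ∑ i, Riem a b p q s i j i l x

/-- Hessian `(Hess f)_{ij} = ∂_i∂_j f − Σ_k Γ^k_{ij} ∂_k f`. -/
def Hess (a b p q s : ℝ) (f : (Fin 4 → ℝ) → ℝ) (i j : Fin 4) (x : Fin 4 → ℝ) : ℝ :=
  pd i (fun y => pd j f y) x - ∑ k, Gam a b p q s k i j x * pd k f x

/-- The matrix `g^{ij}` written out. -/
theorem ginv_eq (a b p q s : ℝ) (x : Fin 4 → ℝ) :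
    ginv a b p q s x =
      !![-gmat a b p q s x 3 3, 0, 0, 1; 0, 1, 0, 0; 0, 0, 1, 0; 1, 0, 0, 0] := by
  refine Matrix.inv_eq_right_inv ?_
  ext i j
  fin_cases i <;> fin_cases j <;> 
    simp [gmat, Matrix.mul_apply, Fin.sum_univ_four]
  ring

theorem pd_eq_of_hasFDerivAt {f : (Fin 4 → ℝ) → ℝ} {f' : (Fin 4 → ℝ) →L[ℝ] ℝ}
    {x : Fin 4 → ℝ} (h : HasFDerivAt f f' x) (i : Fin 4) :
    pd i f x = f' (Pi.single i 1) := by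
  rw [pd, h.fderiv]

theorem pd_const (i : Fin 4) (c : ℝ) (x : Fin 4 → ℝ) : pd i (fun _ => c) x = 0 := by
  simp [pd]

/-- The partial derivatives of `g₄₄`. -/
def gradMetric (a b p q s : ℝ) (x : Fin 4 → ℝ) : Fin 4 → ℝ :=
  ![0, 2 * a * x 1 * x 3 + 2 * p * x 1 + 2 * q * x 2,
    2 * b * x 2 * x 3 + 2 * q * x 1 + 2 * s * x 2,
    a * x 1 ^ 2 + b * x 2 ^ 2]

theorem hasFDerivAt_coord (i : Fin 4) (x : Fin 4 → ℝ) :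
    HasFDerivAt (fun y : Fin 4 → ℝ => y i)
      (ContinuousLinearMap.proj (R := ℝ) (φ := fun _ : Fin 4 => ℝ) i) x :=
  (ContinuousLinearMap.proj (R := ℝ) (φ := fun _ : Fin 4 => ℝ) i).hasFDerivAt

theorem pd_gmat (a b p q s : ℝ) (k i j : Fin 4) (x : Fin 4 → ℝ) :
    pd k (fun y => gmat a b p q s y i j) x =
      if i = 3 ∧ j = 3 then gradMetric a b p q s x k else 0 := by
  by_cases h : i = 3 ∧ j = 3
  · obtain ⟨rfl, rfl⟩ := h
    have h1 := hasFDerivAt_coord 1 x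
    have h2 := hasFDerivAt_coord 2 x
    have h3 := hasFDerivAt_coord 3 x
    have hg := (((h3.mul (((h1.pow 2).const_mul a).add ((h2.pow 2).const_mul b))).add
      ((h1.pow 2).const_mul p)).add ((h1.const_mul (2 * q)).mul h2)).add
      ((h2.pow 2).const_mul s)
    refine (pd_eq_of_hasFDerivAt (hg.congr_of_eventuallyEq (.of_forall fun y => ?_)) k).trans ?_
    · simp [gmat]
    · fin_cases k <;> simp [gradMetric] <;> ring
  · rw [if_neg h]
    simp only [gmat, Matrix.of_apply, if_neg h, pd_const]

/-- The Christoffel symbols written out. -/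
theorem Gam_eq (a b p q s : ℝ) (k i j : Fin 4) :
    Gam a b p q s k i j = fun x =>
      if k = 0 then
        if j = 3 then 1 / 2 * gradMetric a b p q s x i
        else if i = 3 then 1 / 2 * gradMetric a b p q s x j else 0
      else if (k = 1 ∨ k = 2) ∧ i = 3 ∧ j = 3 then -(1 / 2) * gradMetric a b p q s x k
      else 0 := by
  funext x
  simp only [Gam, ginv_eq, pd_gmat, Fin.sum_univ_four]
  fin_cases k <;> fin_cases i <;> fin_cases j <;> simp [gradMetric] <;> ring

/-- The second partial derivatives of `g₄₄`. -/
def hessMetric (a b p q s : ℝ) (x : Fin 4 → ℝ) : Matrix (Fin 4) (Fin 4) ℝ :=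
  !![0, 0, 0, 0;
    0, 2 * a * x 3 + 2 * p, 2 * q, 2 * a * x 1;
    0, 2 * q, 2 * b * x 3 + 2 * s, 2 * b * x 2;
    0, 2 * a * x 1, 2 * b * x 2, 0]

theorem pd_const_mul_gradMetric (a b p q s c : ℝ) (i k : Fin 4) (x : Fin 4 → ℝ) :
    pd i (fun y => c * gradMetric a b p q s y k) x = c * hessMetric a b p q s x i k := by
  have h1 := hasFDerivAt_coord 1 x
  have h2 := hasFDerivAt_coord 2 x
  have h3 := hasFDerivAt_coord 3 x
  match k with
  | 0 => fin_cases i <;> simp [gradMetric, hessMetric, pd_const]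
  | 1 =>
    have h := ((((h1.const_mul (2 * a)).mul h3).add (h1.const_mul (2 * p))).add
      (h2.const_mul (2 * q))).const_mul c
    refine (pd_eq_of_hasFDerivAt h i).trans ?_
    fin_cases i <;> simp [hessMetric]
    ring
  | 2 =>
    have h := ((((h2.const_mul (2 * b)).mul h3).add (h1.const_mul (2 * q))).add
      (h2.const_mul (2 * s))).const_mul c
    refine (pd_eq_of_hasFDerivAt h i).trans ?_
    fin_cases i <;> simp [hessMetric]
    ring
  | 3 =>
    have h := (((h1.pow 2).const_mul a).add ((h2.pow 2).const_mul b)).const_mul c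
    refine (pd_eq_of_hasFDerivAt h i).trans ?_
    fin_cases i <;> simp [hessMetric, -mul_eq_mul_left_iff] <;> ring

/-- The only nonzero component of the Ricci tensor is `ρ₄₄`. -/
theorem Ric_eq (a b p q s : ℝ) (i j : Fin 4) (x : Fin 4 → ℝ) :
    Ric a b p q s i j x =
      if i = 3 ∧ j = 3 then -((a + b) * x 3 + (p + s)) else 0 := by
  have h0 : gradMetric a b p q s x 0 = 0 := rfl
  simp only [Ric, Riem, Gam_eq, Fin.sum_univ_four]
  fin_cases i <;> fin_cases j <;> 
    simp [pd_const, pd_const_mul_gradMetric, hessMetric, h0, -one_div, -neg_mul]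
  ring

/-- The partial derivatives of a function of `x⁴` alone. -/
theorem pd_comp_last {φ : ℝ → ℝ} {φ' : ℝ} {x : Fin 4 → ℝ} (h : HasDerivAt φ φ' (x 3))
    (i : Fin 4) : pd i (fun y => φ (y 3)) x = if i = 3 then φ' else 0 := by
  refine (pd_eq_of_hasFDerivAt (h.comp_hasFDerivAt x (hasFDerivAt_coord 3 x)) i).trans ?_
  fin_cases i <;> simp

/-- for any real constants `c₁, c₂`, the function
`f = ((a + b)/12)(x⁴)³ + ((p + s)/4)(x⁴)² + c₁x⁴ + c₂` satisfies the steady gradient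
Ricci soliton equation `2(Hess f)_{ij} + ρ_{ij} = 0`. -/
theorem gradient_ricci_soliton_steady (a b p q s c₁ c₂ : ℝ) (x : Fin 4 → ℝ)
    (i j : Fin 4) :
    2 * Hess a b p q s
        (fun y => (a + b) / 12 * (y 3) ^ 3 + (p + s) / 4 * (y 3) ^ 2 + c₁ * y 3 + c₂)
        i j x
      + Ric a b p q s i j x = 0 := by
  have hf (k : Fin 4) (y : Fin 4 → ℝ) :
      pd k (fun y => (a + b) / 12 * (y 3) ^ 3 + (p + s) / 4 * (y 3) ^ 2 + c₁ * y 3 + c₂) y =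
        if k = 3 then (a + b) / 4 * y 3 ^ 2 + (p + s) / 2 * y 3 + c₁ else 0 := by
    refine pd_comp_last (φ := fun t => (a + b) / 12 * t ^ 3 + (p + s) / 4 * t ^ 2 + c₁ * t + c₂)
      ?_ k
    convert! (((((hasDerivAt_id (y 3)).pow 3).const_mul ((a + b) / 12)).add
      (((hasDerivAt_id (y 3)).pow 2).const_mul ((p + s) / 4))).add
      ((hasDerivAt_id (y 3)).const_mul c₁)).add_const c₂ using 1
    simp
    ring
  have hf' : pd i (fun y => (a + b) / 4 * y 3 ^ 2 + (p + s) / 2 * y 3 + c₁) x =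
      if i = 3 then (a + b) / 2 * x 3 + (p + s) / 2 else 0 := by
    refine pd_comp_last (φ := fun t => (a + b) / 4 * t ^ 2 + (p + s) / 2 * t + c₁) ?_ i
    convert! ((((hasDerivAt_id (x 3)).pow 2).const_mul ((a + b) / 4)).add
      ((hasDerivAt_id (x 3)).const_mul ((p + s) / 2))).add_const c₁ using 1
    simp
    ring
  have hG : Gam a b p q s 3 i j x = 0 := by simp [Gam_eq]
  simp only [Hess, hf, Ric_eq, Fin.sum_univ_four]
  by_cases hj : j = 3
  · subst hj
    simp only [if_true, hf', hG]
    by_cases hi : i = 3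
    · simp [hi]
      ring
    · simp [hi]
  · simp [hj, hG, pd_const]
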